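/- arXiv:2508.12319 — 2 statements merged into one kernel-verified Lean document; each statement's English description precedes it below -/
import Mathlib

section
/- Let $u : \mathbb{N} \to \mathbb{N}$ satisfy $u(0) = 1$, $u(1) = 3$, $u(2) = 6$, and $u(\ell) = \tfrac{3\ell(\ell+1)}{2} - 3(\ell-1) - 2\,u(\ell-3)$ for all $\ell \ge 3$. Then $u(\ell) = \binom{\ell+2}{2} = \tfrac{(\ell+1)(\ell+2)}{2}$ for all $\ell \ge 0$. -/
/-- The planar vertex count `u(ℓ) = M_ℓ^{2,1}` determined by
`u(ℓ) = 3ℓ(ℓ+1)/2 - 3(ℓ-1) - 2 u(ℓ-3)` equals `(ℓ+2).choose 2 = (ℓ+1)(ℓ+2)/2`. -/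
theorem sg2_vertex_count (u : ℕ → ℕ)
    (h0 : u 0 = 1) (h1 : u 1 = 3) (h2 : u 2 = 6)
    (hrec : ∀ ℓ, 3 ≤ ℓ →
      u ℓ = 3 * (ℓ * (ℓ + 1)) / 2 - 3 * (ℓ - 1) - 2 * u (ℓ - 3)) :
    ∀ ℓ, u ℓ = Nat.choose (ℓ + 2) 2 ∧ u ℓ = (ℓ + 1) * (ℓ + 2) / 2 := by
  have two_mul_u : ∀ ℓ, 2 * u ℓ = (ℓ + 1) * (ℓ + 2) := by
    intro ℓ
    induction ℓ using Nat.strong_induction_on with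
    | _ ℓ ih =>
      match ℓ, ih with
      | 0, _ => simp [h0]
      | 1, _ => simp [h1]
      | 2, _ => simp [h2]
      | m + 3, ih =>
        have hm := ih m (by omega)
        have h := hrec (m + 3) (by omega)
        simp only [Nat.add_sub_cancel] at h
        obtain ⟨k, hk⟩ := Nat.even_mul_succ_self (m + 3)
        ring_nf at hm hk h ⊢
        omega
  intro ℓ
  have hℓ := two_mul_u ℓ
  have hu : u ℓ = (ℓ + 1) * (ℓ + 2) / 2 := by omega
  refine ⟨?_, hu⟩
  rw [hu, Nat.choose_two_right, Nat.add_succ_sub_one, Nat.mul_comm]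
end

section
/- Let $E_{k-1}$, $E_k$, $E_{k+1}$ be finite sets with parity functions $s_{k-1}, s_k$ taking values in $\{-1,0,1\}$ satisfying $\sum_{b \in E_k} s_{k-1}(a,b)\, s_k(b,c) = 0$ for every $a \in E_{k-1}$ and $c \in E_{k+1}$, and strictly positive weights $\mu_{k-1}, \mu_k, \mu_{k+1}$. Then $\ker d_k$ is the internal orthogonal direct sum of the range of $d_{k-1}$ and the space $\mathcal{H}_k = \ker \Delta_k$ of harmonic $k$-forms; consequently, the de Rham cohomology space $H^k = \ker d_k / \operatorname{range} d_{k-1}$ is linearly isomorphic to $\mathcal{H}_k$. -/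
/-- The de Rham derivative `d_j f (e') = ∑ e, s_j(e,e') f(e)` as a linear map. -/
noncomputable def deRhamL {E F : Type*} [Fintype E] (s : E → F → ℤ) :
    (E → ℂ) →ₗ[ℂ] (F → ℂ) where
  toFun f := fun e' => ∑ e, (s e e' : ℂ) * f e
  map_add' f g := by
    funext e'
    simp [mul_add, Finset.sum_add_distrib]
  map_smul' c f := by
    funext e'
    simp [Finset.mul_sum, mul_left_comm]

/-- The dual de Rham derivative
`δ_j f (e) = ∑ e', (μ_j(e')/μ_{j-1}(e)) s_{j-1}(e,e') f(e')` as a linear map. -/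
noncomputable def dualDeRhamL {E F : Type*} [Fintype F] (s : E → F → ℤ)
    (μa : E → ℝ) (μb : F → ℝ) : (F → ℂ) →ₗ[ℂ] (E → ℂ) where
  toFun f := fun e => ∑ e', ((μb e' / μa e : ℝ) : ℂ) * (s e e' : ℂ) * f e'
  map_add' f g := by
    funext e
    simp [mul_add, Finset.sum_add_distrib]
  map_smul' c f := by
    funext e
    simp only [Finset.mul_sum, RingHom.id_apply, Pi.smul_apply, smul_eq_mul]
    exact Finset.sum_congr rfl fun e' _ => by ring

/-- The weighted inner product `⟨f,g⟩ = ∑ e, μ(e) f(e) conj(g(e))`. -/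
noncomputable def formIP {E : Type*} [Fintype E] (μ : E → ℝ) (f g : E → ℂ) : ℂ :=
  ∑ e, (μ e : ℂ) * f e * star (g e)

/-- The Hodge Laplacian `-Δ_k = δ_{k+1} ∘ d_k + d_{k-1} ∘ δ_k` as a linear map. -/
noncomputable def hodgeLap {E0 E1 E2 : Type*}
    [Fintype E0] [Fintype E1] [Fintype E2]
    (s0 : E0 → E1 → ℤ) (s1 : E1 → E2 → ℤ)
    (μ0 : E0 → ℝ) (μ1 : E1 → ℝ) (μ2 : E2 → ℝ) :
    (E1 → ℂ) →ₗ[ℂ] (E1 → ℂ) :=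
  (dualDeRhamL s1 μ1 μ2).comp (deRhamL s1)
    + (deRhamL s0).comp (dualDeRhamL s0 μ0 μ1)

/-- The dual de Rham derivative is the adjoint of the de Rham derivative. -/
theorem formIP_deRhamL_left {E F : Type*} [Fintype E] [Fintype F] (s : E → F → ℤ)
    {μa : E → ℝ} (hμa : ∀ e, 0 < μa e) (μb : F → ℝ) (u : E → ℂ) (h : F → ℂ) :
    formIP μb (deRhamL s u) h = formIP μa u (dualDeRhamL s μa μb h) := by
  simp only [formIP, deRhamL, dualDeRhamL, LinearMap.coe_mk, AddHom.coe_mk, star_sum,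
    Finset.mul_sum, Finset.sum_mul]
  rw [Finset.sum_comm]
  refine Finset.sum_congr rfl fun a _ => Finset.sum_congr rfl fun b _ => ?_
  have ha : (μa a : ℂ) ≠ 0 := by exact_mod_cast (hμa a).ne'
  simp
  field_simp

theorem formIP_self {E : Type*} [Fintype E] (μ : E → ℝ) (f : E → ℂ) :
    formIP μ f f = ((∑ e, μ e * Complex.normSq (f e) : ℝ) : ℂ) := by
  simp [formIP, mul_assoc, Complex.mul_conj]

theorem formIP_star {E : Type*} [Fintype E] (μ : E → ℝ) (f g : E → ℂ) :
    star (formIP μ f g) = formIP μ g f := by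
  simp only [formIP, star_sum]
  refine Finset.sum_congr rfl fun e _ => ?_
  simp
  ring

theorem formIP_add_left {E : Type*} [Fintype E] (μ : E → ℝ) (f g h : E → ℂ) :
    formIP μ (f + g) h = formIP μ f h + formIP μ g h := by
  simp [formIP, mul_add, add_mul, Finset.sum_add_distrib]

theorem formIP_zero_left {E : Type*} [Fintype E] (μ : E → ℝ) (h : E → ℂ) :
    formIP μ 0 h = 0 := by
  simp [formIP]

theorem formIP_zero_right {E : Type*} [Fintype E] (μ : E → ℝ) (h : E → ℂ) :
    formIP μ h 0 = 0 := by
  simp [formIP]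

theorem formIP_self_re_nonneg {E : Type*} [Fintype E] {μ : E → ℝ} (hμ : ∀ e, 0 < μ e)
    (f : E → ℂ) : 0 ≤ (formIP μ f f).re := by
  rw [formIP_self, Complex.ofReal_re]
  exact Finset.sum_nonneg fun e _ => mul_nonneg (hμ e).le (Complex.normSq_nonneg _)

theorem eq_zero_of_formIP_self_re {E : Type*} [Fintype E] {μ : E → ℝ} (hμ : ∀ e, 0 < μ e)
    {f : E → ℂ} (hf : (formIP μ f f).re = 0) : f = 0 := by
  rw [formIP_self, Complex.ofReal_re, Finset.sum_eq_zero_iff_of_nonneg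
    fun e _ => mul_nonneg (hμ e).le (Complex.normSq_nonneg _)] at hf
  funext e
  simpa [(hμ e).ne'] using hf e (Finset.mem_univ e)

theorem formIP_dualDeRhamL_left {E F : Type*} [Fintype E] [Fintype F] (s : E → F → ℤ)
    {μa : E → ℝ} (hμa : ∀ e, 0 < μa e) (μb : F → ℝ) (h : F → ℂ) (u : E → ℂ) :
    formIP μa (dualDeRhamL s μa μb h) u = formIP μb h (deRhamL s u) := by
  rw [← formIP_star, ← formIP_deRhamL_left s hμa, formIP_star]

theorem dualDeRhamL_eq_zero_of_deRhamL {E F : Type*} [Fintype E] [Fintype F] (s : E → F → ℤ)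
    {μa : E → ℝ} (hμa : ∀ e, 0 < μa e) (μb : F → ℝ) {f : F → ℂ}
    (hf : deRhamL s (dualDeRhamL s μa μb f) = 0) : dualDeRhamL s μa μb f = 0 := by
  apply eq_zero_of_formIP_self_re hμa
  rw [formIP_dualDeRhamL_left s hμa, hf, formIP_zero_right, Complex.zero_re]

theorem deRhamL_eq_zero_of_dualDeRhamL {E F : Type*} [Fintype E] [Fintype F] (s : E → F → ℤ)
    {μa : E → ℝ} (hμa : ∀ e, 0 < μa e) {μb : F → ℝ} (hμb : ∀ e, 0 < μb e) {u : E → ℂ}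
    (hu : dualDeRhamL s μa μb (deRhamL s u) = 0) : deRhamL s u = 0 := by
  apply eq_zero_of_formIP_self_re hμb
  rw [formIP_deRhamL_left s hμa, hu, formIP_zero_right, Complex.zero_re]

/-- Every form is the sum of an exact form and a coclosed form. -/
theorem exists_eq_deRhamL_add {E F : Type*} [Fintype E] [Fintype F] (s : E → F → ℤ)
    {μa : E → ℝ} (hμa : ∀ e, 0 < μa e) {μb : F → ℝ} (hμb : ∀ e, 0 < μb e) (f : F → ℂ) :
    ∃ u h, dualDeRhamL s μa μb h = 0 ∧ f = deRhamL s u + h := by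
  let T : (F → ℂ) →ₗ[ℂ] (F → ℂ) := (deRhamL s).comp (dualDeRhamL s μa μb)
  have hdisj : Disjoint (LinearMap.range T) (LinearMap.ker T) := by
    rw [Submodule.disjoint_def]
    rintro _ ⟨g, rfl⟩ hg
    exact deRhamL_eq_zero_of_dualDeRhamL s hμa hμb (dualDeRhamL_eq_zero_of_deRhamL s hμa μb hg)
  have htop : LinearMap.range T ⊔ LinearMap.ker T = ⊤ :=
    Submodule.eq_top_of_disjoint _ _ (LinearMap.finrank_range_add_finrank_ker T).ge hdisj
  obtain ⟨_, ⟨g, rfl⟩, h, hh, hfh⟩ := Submodule.mem_sup.mp (htop ▸ Submodule.mem_top : f ∈ _)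
  exact ⟨_, h, dualDeRhamL_eq_zero_of_deRhamL s hμa μb hh, hfh.symm⟩

/-- A form is harmonic if and only if it is closed and coclosed. -/
theorem mem_ker_hodgeLap {E0 E1 E2 : Type*} [Fintype E0] [Fintype E1] [Fintype E2]
    (s0 : E0 → E1 → ℤ) (s1 : E1 → E2 → ℤ) {μ0 : E0 → ℝ} {μ1 : E1 → ℝ} {μ2 : E2 → ℝ}
    (hμ0 : ∀ e, 0 < μ0 e) (hμ1 : ∀ e, 0 < μ1 e) (hμ2 : ∀ e, 0 < μ2 e) (h : E1 → ℂ) :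
    h ∈ LinearMap.ker (hodgeLap s0 s1 μ0 μ1 μ2) ↔
      deRhamL s1 h = 0 ∧ dualDeRhamL s0 μ0 μ1 h = 0 := by
  rw [LinearMap.mem_ker, hodgeLap, LinearMap.add_apply, LinearMap.comp_apply,
    LinearMap.comp_apply]
  constructor
  · intro hh
    have key := congrArg (fun g => (formIP μ1 g h).re) hh
    simp only [formIP_add_left, formIP_zero_left, Complex.add_re, Complex.zero_re,
      formIP_dualDeRhamL_left s1 hμ1, formIP_deRhamL_left s0 hμ0] at key
    have h2 := formIP_self_re_nonneg hμ2 (deRhamL s1 h)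
    have h0 := formIP_self_re_nonneg hμ0 (dualDeRhamL s0 μ0 μ1 h)
    exact ⟨eq_zero_of_formIP_self_re hμ2 (by linarith),
      eq_zero_of_formIP_self_re hμ0 (by linarith)⟩
  · rintro ⟨h1, h0⟩
    rw [h1, h0, map_zero, map_zero, add_zero]

theorem deRhamL_deRhamL {E0 E1 E2 : Type*} [Fintype E0] [Fintype E1]
    (s0 : E0 → E1 → ℤ) (s1 : E1 → E2 → ℤ)
    (horth : ∀ (a : E0) (c : E2), ∑ b, s0 a b * s1 b c = 0) (u : E0 → ℂ) :
    deRhamL s1 (deRhamL s0 u) = 0 := by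
  funext c
  simp only [deRhamL, LinearMap.coe_mk, AddHom.coe_mk, Finset.mul_sum, Pi.zero_apply]
  rw [Finset.sum_comm]
  refine Finset.sum_eq_zero fun a _ => ?_
  have hac : ∑ b, (s0 a b : ℂ) * (s1 b c : ℂ) = 0 := by exact_mod_cast horth a c
  calc ∑ b, (s1 b c : ℂ) * ((s0 a b : ℂ) * u a)
      = (∑ b, (s0 a b : ℂ) * (s1 b c : ℂ)) * u a := by
        rw [Finset.sum_mul]
        exact Finset.sum_congr rfl fun b _ => by ring
    _ = 0 := by rw [hac, zero_mul]

/-- `ker d_k` is the orthogonal direct sum of `range d_{k-1}` and the harmonic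
`k`-forms; consequently the de Rham cohomology `H^k = ker d_k / range d_{k-1}`
is linearly isomorphic to the space of harmonic `k`-forms. -/
theorem cohomology_iso_harmonic {E0 E1 E2 : Type*}
    [Fintype E0] [Fintype E1] [Fintype E2]
    (s0 : E0 → E1 → ℤ) (s1 : E1 → E2 → ℤ)
    (hs0 : ∀ a b, s0 a b ∈ ({-1, 0, 1} : Set ℤ))
    (hs1 : ∀ b c, s1 b c ∈ ({-1, 0, 1} : Set ℤ))
    (horth : ∀ (a : E0) (c : E2), ∑ b, s0 a b * s1 b c = 0)
    (μ0 : E0 → ℝ) (μ1 : E1 → ℝ) (μ2 : E2 → ℝ)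
    (hμ0 : ∀ e, 0 < μ0 e) (hμ1 : ∀ e, 0 < μ1 e) (hμ2 : ∀ e, 0 < μ2 e) :
    LinearMap.range (deRhamL (F := E1) s0) ≤ LinearMap.ker (deRhamL s1) ∧
    LinearMap.ker (hodgeLap s0 s1 μ0 μ1 μ2) ≤ LinearMap.ker (deRhamL s1) ∧
    (∀ (u : E0 → ℂ) (h : E1 → ℂ), h ∈ LinearMap.ker (hodgeLap s0 s1 μ0 μ1 μ2) →
      formIP μ1 (deRhamL s0 u) h = 0) ∧
    (∀ f ∈ LinearMap.ker (deRhamL s1), ∃ (u : E0 → ℂ),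
      ∃ h ∈ LinearMap.ker (hodgeLap s0 s1 μ0 μ1 μ2), f = deRhamL s0 u + h) ∧
    Nonempty
      ((↥(LinearMap.ker (deRhamL s1)) ⧸
          (LinearMap.range (deRhamL (F := E1) s0)).comap
            (LinearMap.ker (deRhamL s1)).subtype)
        ≃ₗ[ℂ] ↥(LinearMap.ker (hodgeLap s0 s1 μ0 μ1 μ2))) := by
  have hd := deRhamL_deRhamL s0 s1 horth
  have hker := mem_ker_hodgeLap s0 s1 hμ0 hμ1 hμ2
  have hrange : LinearMap.range (deRhamL s0) ≤ LinearMap.ker (deRhamL s1) := by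
    rintro _ ⟨u, rfl⟩
    exact hd u
  have hharm : LinearMap.ker (hodgeLap s0 s1 μ0 μ1 μ2) ≤ LinearMap.ker (deRhamL s1) :=
    fun h hh => ((hker h).mp hh).1
  have hperp : ∀ (u : E0 → ℂ) (h : E1 → ℂ), h ∈ LinearMap.ker (hodgeLap s0 s1 μ0 μ1 μ2) →
      formIP μ1 (deRhamL s0 u) h = 0 := fun u h hh => by
    rw [formIP_deRhamL_left s0 hμ0, ((hker h).mp hh).2, formIP_zero_right]
  have hdecomp : ∀ f ∈ LinearMap.ker (deRhamL s1), ∃ (u : E0 → ℂ),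
      ∃ h ∈ LinearMap.ker (hodgeLap s0 s1 μ0 μ1 μ2), f = deRhamL s0 u + h := by
    intro f hf
    obtain ⟨u, h, hh, rfl⟩ := exists_eq_deRhamL_add s0 hμ0 hμ1 f
    refine ⟨u, h, (hker h).mpr ⟨?_, hh⟩, rfl⟩
    simpa [hd u] using hf
  refine ⟨hrange, hharm, hperp, hdecomp, ?_⟩
  have hcompl : IsCompl
      ((LinearMap.range (deRhamL (F := E1) s0)).comap (LinearMap.ker (deRhamL s1)).subtype)
      ((LinearMap.ker (hodgeLap s0 s1 μ0 μ1 μ2)).comap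
        (LinearMap.ker (deRhamL s1)).subtype) := by
    refine ⟨Submodule.disjoint_def.mpr ?_, codisjoint_iff.mpr (eq_top_iff.mpr ?_)⟩
    · rintro ⟨f, hf⟩ ⟨u, hu⟩ hh
      obtain rfl : deRhamL s0 u = f := hu
      apply Subtype.ext
      exact eq_zero_of_formIP_self_re hμ1 (congrArg Complex.re (hperp u _ hh))
    · rintro ⟨f, hf⟩ -
      obtain ⟨u, h, hh, rfl⟩ := hdecomp f hf
      exact Submodule.mem_sup.mpr
        ⟨⟨deRhamL s0 u, hd u⟩, ⟨u, rfl⟩, ⟨h, hharm hh⟩, hh, rfl⟩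
  exact ⟨(Submodule.quotientEquivOfIsCompl _ _ hcompl).trans
    (Submodule.comapSubtypeEquivOfLe hharm)⟩
end
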